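/- (Strong completeness of S1+SP) For every set of modal formulas Φ and every modal formula φ: if Φ ⊨ φ (every interpretation satisfying Φ satisfies φ), then Φ ⊢ φ in S1+SP. -/

import Mathlib

/-- Modal formulas over countably many propositional variables x₀, x₁, …. -/
inductive Fm : Type
  | var : ℕ → Fm
  | neg : Fm → Fm
  | imp : Fm → Fm → Fm
  | box : Fm → Fm
deriving DecidableEq

namespace Fm

/-- ⊤ := x₀ → x₀ -/
def top : Fm := imp (var 0) (var 0)

/-- φ ∧ ψ := ¬(φ → ¬ψ) -/
def conj (φ ψ : Fm) : Fm := neg (imp φ (neg ψ))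

/-- φ ↔ ψ := (φ → ψ) ∧ (ψ → φ) -/
def biimp (φ ψ : Fm) : Fm := conj (imp φ ψ) (imp ψ φ)

/-- strict equivalence: φ ≡ ψ := □(φ → ψ) ∧ □(ψ → φ) -/
def equiv (φ ψ : Fm) : Fm := conj (box (imp φ ψ)) (box (imp ψ φ))

/-- φ[x := ψ]: substitution of ψ for all occurrences of the variable x in φ. -/
def subst (φ : Fm) (x : ℕ) (ψ : Fm) : Fm :=
  match φ with
  | var y => if y = x then ψ else var y
  | neg χ => neg (subst χ x ψ)
  | imp χ δ => imp (subst χ x ψ) (subst δ x ψ)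
  | box χ => box (subst χ x ψ)

/-- Propositional (two-valued) evaluation of a modal formula, treating
variables and boxed formulas as atoms. -/
def pEval (v : Fm → Bool) : Fm → Bool
  | var n => v (var n)
  | neg φ => !(pEval v φ)
  | imp φ ψ => !(pEval v φ) || pEval v ψ
  | box φ => v (box φ)

/-- φ has the form of a propositional tautology, i.e. φ is a substitution
instance of a propositional tautology. -/
def isTautInstance (φ : Fm) : Prop := ∀ v : Fm → Bool, pEval v φ = true

/-- The axioms (i)–(iii) of Lewis system S1 (Lemmon-style). -/
inductive S1Axiom : Fm → Prop
  | taut {φ} : isTautInstance φ → S1Axiom φ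
  | ax2 (φ) : S1Axiom (imp (box φ) φ)
  | ax3 (φ ψ χ) :
      S1Axiom (imp (conj (box (imp φ ψ)) (box (imp ψ χ))) (box (imp φ χ)))

/-- The identity axioms (iv)–(vi), i.e. the Substitution Principle SP. -/
inductive SPAxiom : Fm → Prop
  | ax4 (φ ψ) : SPAxiom (imp (equiv φ ψ) (equiv (neg φ) (neg ψ)))
  | ax5 (φ ψ φ' ψ') :
      SPAxiom (imp (conj (equiv φ ψ) (equiv φ' ψ'))
        (equiv (imp φ φ') (imp ψ ψ')))
  | ax6 (φ ψ) : SPAxiom (imp (equiv φ ψ) (equiv (box φ) (box ψ)))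

/-- Derivability in S1+SP from a set Φ of premises: axioms (i)–(vi),
modus ponens, and Axiom Necessitation AN restricted to axioms (i)–(iii). -/
inductive S1SP : Set Fm → Fm → Prop
  | prem {Φ φ} : φ ∈ Φ → S1SP Φ φ
  | axm {Φ φ} : S1Axiom φ → S1SP Φ φ
  | spAxm {Φ φ} : SPAxiom φ → S1SP Φ φ
  | mp {Φ φ ψ} : S1SP Φ (imp φ ψ) → S1SP Φ φ → S1SP Φ ψ
  | an {Φ φ} : S1Axiom φ → S1SP Φ (box φ)

end Fm

/-- An algebraic model: a Boolean algebra (with complement `ᶜ` and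
implication `⇨`), a set TRUE of true propositions, and a unary operation f□,
satisfying the model conditions (1)–(6). -/
structure MModel where
  M : Type
  [ba : BooleanAlgebra M]
  TRUE : Set M
  fbox : M → M
  bot_not_true : ⊥ ∉ TRUE
  top_true : ⊤ ∈ TRUE
  compl_true : ∀ m : M, mᶜ ∈ TRUE ↔ m ∉ TRUE
  himp_true : ∀ m m' : M, (m ⇨ m') ∈ TRUE ↔ (m ∉ TRUE ∨ m' ∈ TRUE)
  fbox_true : ∀ m : M, fbox m ∈ TRUE ↔ m = ⊤
  fbox_le : ∀ m : M, fbox m ≤ m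
  fbox_trans : ∀ m m' m'' : M,
    fbox (m ⇨ m') ⊓ fbox (m' ⇨ m'') ≤ fbox (m ⇨ m'')

attribute [instance] MModel.ba

namespace MModel

/-- The canonical homomorphic extension of an assignment γ of propositions
to the variables. -/
def eval (𝓜 : MModel) (γ : ℕ → 𝓜.M) : Fm → 𝓜.M
  | .var n => γ n
  | .neg φ => (𝓜.eval γ φ)ᶜ
  | .imp φ ψ => 𝓜.eval γ φ ⇨ 𝓜.eval γ ψ
  | .box φ => 𝓜.fbox (𝓜.eval γ φ)

/-- Satisfaction: (𝓜, γ) ⊨ φ iff γ(φ) ∈ TRUE. -/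
def sat (𝓜 : MModel) (γ : ℕ → 𝓜.M) (φ : Fm) : Prop := 𝓜.eval γ φ ∈ 𝓜.TRUE

end MModel

namespace Fm

theorem S1SP.mono {Φ Ψ : Set Fm} {φ : Fm} (h : S1SP Φ φ) : Φ ⊆ Ψ → S1SP Ψ φ := by
  induction h with
  | prem h => intro s; exact .prem (s h)
  | axm h => intro _; exact .axm h
  | spAxm h => intro _; exact .spAxm h
  | mp _ _ h1 h2 => intro s; exact .mp (h1 s) (h2 s)
  | an h => intro _; exact .an h

theorem S1SP.t {Φ : Set Fm} {φ : Fm} (h : isTautInstance φ) : S1SP Φ φ := .axm (.taut h)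

theorem S1SP.weak {Φ : Set Fm} {φ : Fm} (ψ : Fm) (h : S1SP Φ φ) : S1SP Φ (imp ψ φ) :=
  .mp (.t (by intro v; simp only [pEval]; grind)) h

theorem S1SP.ded {Φ Ψ : Set Fm} {ψ φ : Fm} (h : S1SP Ψ φ) :
    Ψ = insert ψ Φ → S1SP Φ (imp ψ φ) := by
  induction h with
  | prem h =>
    rintro rfl
    rcases h with rfl | h
    · exact .t (by intro v; simp only [pEval]; grind)
    · exact .weak _ (.prem h)
  | axm h => intro _; exact .weak _ (.axm h)
  | spAxm h => intro _; exact .weak _ (.spAxm h)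
  | @mp a b _ _ h1 h2 =>
    intro s
    refine .mp (.mp (.t (φ := imp (imp ψ (imp a b)) (imp (imp ψ a) (imp ψ b))) ?_) (h1 s)) (h2 s)
    intro v; simp only [pEval]; grind
  | an h => intro _; exact .weak _ (.an h)

theorem S1SP.chain {c : Set (Set Fm)} (hc : IsChain (· ⊆ ·) c) (hne : c.Nonempty)
    {Ψ : Set Fm} {φ : Fm} (h : S1SP Ψ φ) : Ψ = ⋃₀ c → ∃ s ∈ c, S1SP s φ := by
  obtain ⟨s0, hs0⟩ := hne
  induction h with
  | prem h =>
    rintro rfl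
    obtain ⟨s, hs, h⟩ := h
    exact ⟨s, hs, .prem h⟩
  | axm h => intro _; exact ⟨s0, hs0, .axm h⟩
  | spAxm h => intro _; exact ⟨s0, hs0, .spAxm h⟩
  | mp _ _ h1 h2 =>
    intro e
    obtain ⟨s, hs, h1⟩ := h1 e
    obtain ⟨t, ht, h2⟩ := h2 e
    rcases hc.total hs ht with l | l
    · exact ⟨t, ht, .mp (h1.mono l) h2⟩
    · exact ⟨s, hs, .mp h1 (h2.mono l)⟩
  | an h => intro _; exact ⟨s0, hs0, .an h⟩

structure MCS where
  G : Set Fm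
  ded : ∀ {φ}, S1SP G φ → φ ∈ G
  neg_iff : ∀ φ, neg φ ∈ G ↔ φ ∉ G

theorem lindenbaum {Φ : Set Fm} {φ : Fm} (h : ¬ S1SP Φ φ) :
    ∃ m : MCS, Φ ⊆ m.G ∧ φ ∉ m.G := by
  obtain ⟨G, hΦ, hG⟩ := zorn_subset_nonempty {S : Set Fm | ¬ S1SP S φ} (by
    intro c hc hch hne
    refine ⟨⋃₀ c, ?_, fun s hs => Set.subset_sUnion_of_mem hs⟩
    intro hd
    obtain ⟨s, hs, hd⟩ := S1SP.chain hch hne hd rfl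
    exact hc hs hd) Φ h
  have key : ∀ ψ, ψ ∉ G → S1SP G (imp ψ φ) := by
    intro ψ hψ
    by_contra hn
    have : ¬ S1SP (insert ψ G) φ := fun hd => hn (hd.ded rfl)
    exact hψ (hG.2 this (Set.subset_insert _ _) (Set.mem_insert _ _))
  have hd : ∀ {ψ}, S1SP G ψ → ψ ∈ G := by
    intro ψ hd
    by_contra hn
    exact hG.1 (.mp (key ψ hn) hd)
  refine ⟨⟨G, hd, ?_⟩, hΦ, fun hp => hG.1 (.prem hp)⟩
  intro ψ
  constructor
  · intro h1 h2
    refine hG.1 (.mp (.mp (.t (φ := imp (neg ψ) (imp ψ φ)) ?_) (.prem h1)) (.prem h2))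
    intro v; simp only [pEval]; grind
  · intro h1
    by_contra h2
    refine hG.1 (.mp (.mp (.t (φ := imp (imp ψ φ) (imp (imp (neg ψ) φ) φ)) ?_)
      (key _ h1)) (key _ h2))
    intro v; simp only [pEval]; grind

namespace MCS
variable (m : MCS)

theorem mp {a b : Fm} (h : imp a b ∈ m.G) (h' : a ∈ m.G) : b ∈ m.G :=
  m.ded (.mp (.prem h) (.prem h'))

theorem imp_iff (a b : Fm) : imp a b ∈ m.G ↔ (a ∉ m.G ∨ b ∈ m.G) := by
  constructor
  · intro h
    by_cases ha : a ∈ m.G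
    · exact .inr (m.mp h ha)
    · exact .inl ha
  · rintro (h | h)
    · refine m.ded (.mp (.t (φ := imp (neg a) (imp a b)) ?_) (.prem ((m.neg_iff a).2 h)))
      intro v; simp only [pEval]; grind
    · exact m.ded (.weak _ (.prem h))

theorem conj_iff (a b : Fm) : conj a b ∈ m.G ↔ (a ∈ m.G ∧ b ∈ m.G) := by
  unfold conj
  rw [m.neg_iff, m.imp_iff, m.neg_iff]; tauto

/-- necessity in the theory -/
def N (a : Fm) : Prop := box a ∈ m.G

theorem nt {a : Fm} (h : isTautInstance a) : m.N a := m.ded (.an (.taut h))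

theorem n_true {a : Fm} (h : m.N a) : a ∈ m.G := m.mp (m.ded (.axm (.ax2 a))) h

def E (a b : Fm) : Prop := m.N (imp a b) ∧ m.N (imp b a)

theorem E_iff (a b : Fm) : equiv a b ∈ m.G ↔ m.E a b := m.conj_iff _ _

theorem n_trans {a b c : Fm} (h : m.N (imp a b)) (h' : m.N (imp b c)) : m.N (imp a c) :=
  m.mp (m.ded (.axm (.ax3 a b c))) ((m.conj_iff _ _).2 ⟨h, h'⟩)

theorem E_neg {a b : Fm} (h : m.E a b) : m.E (neg a) (neg b) :=
  (m.E_iff _ _).1 (m.mp (m.ded (.spAxm (.ax4 a b))) ((m.E_iff _ _).2 h))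

theorem E_box {a b : Fm} (h : m.E a b) : m.E (box a) (box b) :=
  (m.E_iff _ _).1 (m.mp (m.ded (.spAxm (.ax6 a b))) ((m.E_iff _ _).2 h))

theorem E_imp {a b a' b' : Fm} (h : m.E a b) (h' : m.E a' b') : m.E (imp a a') (imp b b') :=
  (m.E_iff _ _).1 (m.mp (m.ded (.spAxm (.ax5 a b a' b')))
    ((m.conj_iff _ _).2 ⟨(m.E_iff _ _).2 h, (m.E_iff _ _).2 h'⟩))

theorem E_conj {a b a' b' : Fm} (h : m.E a b) (h' : m.E a' b') : m.E (conj a a') (conj b b') :=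
  m.E_neg (m.E_imp h (m.E_neg h'))

theorem E_symm {a b : Fm} (h : m.E a b) : m.E b a := ⟨h.2, h.1⟩

theorem E_true {a b : Fm} (h : m.E a b) : a ∈ m.G ↔ b ∈ m.G :=
  ⟨m.mp (m.n_true h.1), m.mp (m.n_true h.2)⟩

theorem E_N {a b : Fm} (h : m.E a b) : m.N a ↔ m.N b := m.E_true (m.E_box h)

theorem n_iff_top (a : Fm) : m.N a ↔ m.N (imp top a) := by
  apply m.E_N
  constructor <;> refine m.nt ?_ <;> intro v <;> simp only [pEval, top] <;> grind

theorem n_E_top {a : Fm} (h : m.N a) : m.E a top :=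
  ⟨m.nt (by intro v; simp only [pEval, top]; grind), (m.n_iff_top a).1 h⟩

theorem n_taut {a b : Fm} (h : m.N a) (ht : isTautInstance (imp a b)) : m.N b :=
  (m.n_iff_top b).2 (m.n_trans ((m.n_iff_top a).1 h) (m.nt ht))

theorem n_conj {a b : Fm} (h : m.N a) (h' : m.N b) : m.N (conj a b) :=
  (m.E_N (m.E_conj (m.n_E_top h) (m.n_E_top h'))).2
    (m.nt (by intro v; simp only [pEval, top, conj]; grind))

theorem n_taut2 {a b c : Fm} (h : m.N a) (h' : m.N b)
    (ht : ∀ v, pEval v a = true → pEval v b = true → pEval v c = true) : m.N c :=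
  m.n_taut (m.n_conj h h') (by intro v; have := ht v; simp only [pEval, conj]; grind)

def setoid : Setoid Fm where
  r := m.E
  iseqv := ⟨fun a => by
      constructor <;> refine m.nt ?_ <;> intro v <;> simp only [pEval] <;> grind,
    fun h => m.E_symm h,
    fun h h' => ⟨m.n_trans h.1 h'.1, m.n_trans h'.2 h.2⟩⟩

def Q : Type := Quotient m.setoid

def disj (a b : Fm) : Fm := imp (neg a) b

def qle : m.Q → m.Q → Prop :=
  Quotient.lift₂ (s₁ := m.setoid) (s₂ := m.setoid) (fun a b => m.N (imp a b))
    (fun _ _ _ _ h h' => propext (m.E_N (m.E_imp h h')))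

def qneg : m.Q → m.Q := Quotient.map (sa := m.setoid) (sb := m.setoid) neg (fun _ _ h => m.E_neg h)
def qbox : m.Q → m.Q := Quotient.map (sa := m.setoid) (sb := m.setoid) box (fun _ _ h => m.E_box h)
def qimp : m.Q → m.Q → m.Q := Quotient.map₂ (sa := m.setoid) (sb := m.setoid) (sc := m.setoid) imp (fun _ _ h _ _ h' => m.E_imp h h')
def qinf : m.Q → m.Q → m.Q := Quotient.map₂ (sa := m.setoid) (sb := m.setoid) (sc := m.setoid) conj (fun _ _ h _ _ h' => m.E_conj h h')
def qsup : m.Q → m.Q → m.Q := Quotient.map₂ (sa := m.setoid) (sb := m.setoid) (sc := m.setoid) disj (fun _ _ h _ _ h' => m.E_imp (m.E_neg h) h')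
def cl (a : Fm) : m.Q := Quotient.mk m.setoid a

theorem mk_eq {a b : Fm} : m.cl a = m.cl b ↔ m.E a b :=
  ⟨fun h => Quotient.exact (s := m.setoid) h, fun h => Quotient.sound (s := m.setoid) h⟩

theorem ind {p : m.Q → Prop} (h : ∀ a, p (m.cl a)) (q : m.Q) : p q := Quotient.ind h q

instance : LE m.Q := ⟨m.qle⟩

theorem le_taut {a b : Fm} (h : ∀ v, pEval v a = true → pEval v b = true) :
    m.qle (m.cl a) (m.cl b) :=
  m.nt (by intro v; have := h v; simp only [pEval]; grind)

theorem E_taut {a b : Fm} (h : ∀ v, pEval v a = pEval v b) : m.cl a = m.cl b :=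
  m.mk_eq.2 ⟨m.le_taut fun v => by rw [h v]; exact id, m.le_taut fun v => by rw [h v]; exact id⟩

instance ba : BooleanAlgebra m.Q where
  le := m.qle
  sup := m.qsup
  inf := m.qinf
  compl := m.qneg
  himp := m.qimp
  top := m.cl top
  bot := m.cl (neg top)
  le_refl := m.ind fun a => m.le_taut fun v h => h
  le_trans := m.ind fun a => m.ind fun b => m.ind fun c => m.n_trans
  le_antisymm := m.ind fun a => m.ind fun b => fun h h' => m.mk_eq.2 ⟨h, h'⟩
  le_sup_left := m.ind fun a => m.ind fun b =>
    m.le_taut (b := disj a b) (by intro v; simp only [pEval, disj]; grind)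
  le_sup_right := m.ind fun a => m.ind fun b =>
    m.le_taut (b := disj a b) (by intro v; simp only [pEval, disj]; grind)
  sup_le := m.ind fun a => m.ind fun b => m.ind fun c => fun h h' =>
    m.n_taut2 (a := imp a c) (b := imp b c) (c := imp (disj a b) c) h h'
      (by intro v; simp only [pEval, disj]; grind)
  inf_le_left := m.ind fun a => m.ind fun b =>
    m.le_taut (a := conj a b) (by intro v; simp only [pEval, conj]; grind)
  inf_le_right := m.ind fun a => m.ind fun b =>
    m.le_taut (a := conj a b) (by intro v; simp only [pEval, conj]; grind)
  le_inf := m.ind fun a => m.ind fun b => m.ind fun c => fun h h' =>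
    m.n_taut2 (a := imp a b) (b := imp a c) (c := imp a (conj b c)) h h'
      (by intro v; simp only [pEval, conj]; grind)
  le_sup_inf := m.ind fun a => m.ind fun b => m.ind fun c =>
    m.le_taut (a := conj (disj a b) (disj a c)) (b := disj a (conj b c))
      (by intro v; simp only [pEval, conj, disj]; grind)
  inf_compl_le_bot := m.ind fun a =>
    m.le_taut (a := conj a (neg a)) (b := neg top)
      (by intro v; simp only [pEval, conj, top]; grind)
  top_le_sup_compl := m.ind fun a =>
    m.le_taut (a := top) (b := disj a (neg a))
      (by intro v; simp only [pEval, disj, top]; grind)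
  le_top := m.ind fun a => m.le_taut (b := top) (by intro v; simp only [pEval, top]; grind)
  bot_le := m.ind fun a => m.le_taut (a := neg top) (by intro v; simp only [pEval, top]; grind)
  himp_eq := m.ind fun a => m.ind fun b =>
    m.E_taut (a := imp a b) (b := disj b (neg a))
      (by intro v; simp only [pEval, disj]; grind)

def qtrue : Set m.Q := {q | Quotient.lift (s := m.setoid) (fun a => a ∈ m.G)
  (fun _ _ h => propext (m.E_true h)) q}

def model : MModel where
  M := m.Q
  TRUE := m.qtrue
  fbox := m.qbox
  bot_not_true := fun h => (m.neg_iff top).1 h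
    (m.n_true (m.nt (by intro v; simp only [pEval, top]; grind)))
  top_true := m.n_true (a := top) (m.nt (by intro v; simp only [pEval, top]; grind))
  compl_true := m.ind fun a => m.neg_iff a
  himp_true := m.ind fun a => m.ind fun b => m.imp_iff a b
  fbox_true := m.ind fun a =>
    ⟨fun h => m.mk_eq.2 (m.n_E_top h), fun h => (m.n_iff_top a).2 (m.mk_eq.1 h).2⟩
  fbox_le := m.ind fun a => m.ded (.an (.ax2 a))
  fbox_trans := m.ind fun a => m.ind fun b => m.ind fun c => m.ded (.an (.ax3 a b c))

theorem eval_eq (a : Fm) : m.model.eval (fun n => m.cl (var n)) a = m.cl a := by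
  induction a with
  | var n => rfl
  | neg a h => exact congrArg m.qneg h
  | imp a b h h2 => exact congrArg₂ m.qimp h h2
  | box a h => exact congrArg m.qbox h

theorem sat_iff (a : Fm) : m.model.sat (fun n => m.cl (var n)) a ↔ a ∈ m.G := by
  unfold MModel.sat
  rw [eval_eq]; rfl

end MCS
end Fm

open Fm in
/-- Strong completeness of S1+SP. -/
theorem completeness (Φ : Set Fm) (φ : Fm)
    (h : ∀ (𝓜 : MModel) (γ : ℕ → 𝓜.M), (∀ χ ∈ Φ, 𝓜.sat γ χ) → 𝓜.sat γ φ) :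
    S1SP Φ φ := by
  by_contra hn
  obtain ⟨m, hΦ, hφ⟩ := lindenbaum hn
  exact hφ ((m.sat_iff φ).1 (h m.model _ fun χ hχ => (m.sat_iff χ).2 (hΦ hχ)))
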